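/- (Corollary: any state with the Φ_E8 correlations is entangled) Define w : ℕ → ℝ by w 0 = 1, w 1 = w 2 = w 3 = 0, w 4 = 1/81, w 5 = 2/243, w 6 = 4/729, w 7 = 22/2187. Let ρ be a positive semidefinite complex matrix on ℂ^{2^7} ⊗ ℂ^{2^7} with trace 1 such that tr(S · ρ) = 1, where S is the swap of the two 2^7-dimensional factors, and such that tr((E_s ⊗ E_sᴴ) · ρ) = w (wt s) for every s : Fin 7 → Fin 4. Then ρ is not separable: there is no finite family of reals p_i ≥ 0 and density matrices σ_i, τ_i on ℂ^{2^7} with ρ = Σ_i p_i · (σ_i ⊗ τ_i). -/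

import Mathlib

open Matrix Kronecker ComplexOrder

/-- The four Pauli matrices `σ₀, σ₁, σ₂, σ₃`. -/
def pauli : Fin 4 → Matrix (Fin 2) (Fin 2) ℂ :=
  ![!![1, 0; 0, 1], !![0, 1; 1, 0], !![0, -Complex.I; Complex.I, 0], !![1, 0; 0, -1]]

/-- The Pauli string `E_s`, `E_s x y = ∏_k (σ_{s k}) (x k) (y k)`. -/
def pauliString (n : ℕ) (s : Fin n → Fin 4) :
    Matrix (Fin n → Fin 2) (Fin n → Fin 2) ℂ :=
  Matrix.of fun x y => ∏ k, pauli (s k) (x k) (y k)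

/-- The weight of a Pauli label: the number of non-identity tensor factors. -/
def wt {n : ℕ} (s : Fin n → Fin 4) : ℕ :=
  (Finset.univ.filter fun k => s k ≠ 0).card

/-- The swap operator on `ℂ^{2^n} ⊗ ℂ^{2^n}`. -/
def swapN (n : ℕ) :
    Matrix ((Fin n → Fin 2) × (Fin n → Fin 2)) ((Fin n → Fin 2) × (Fin n → Fin 2)) ℂ :=
  Matrix.of fun p q => if p.1 = q.2 ∧ p.2 = q.1 then 1 else 0

/-- The diagonal weights derived from the `Φ_E8` correlations. -/
noncomputable def wFn : ℕ → ℝ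
  | 0 => 1
  | 4 => 1 / 81
  | 5 => 2 / 243
  | 6 => 4 / 729
  | 7 => 22 / 2187
  | _ => 0

abbrev M7 := Matrix (Fin 7 → Fin 2) (Fin 7 → Fin 2) ℂ

/-- Tensor product of seven one-qubit matrices. -/
def tens (A : Fin 7 → Matrix (Fin 2) (Fin 2) ℂ) : M7 :=
  Matrix.of fun x y => ∏ k, A k (x k) (y k)

lemma pauliString_eq (s : Fin 7 → Fin 4) : pauliString 7 s = tens (fun k => pauli (s k)) := rfl

lemma tens_mul (A B : Fin 7 → Matrix (Fin 2) (Fin 2) ℂ) :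
    tens A * tens B = tens (fun k => A k * B k) := by
  ext x y
  simp only [tens, Matrix.mul_apply, Matrix.of_apply]
  rw [Finset.prod_univ_sum]
  simp [Finset.prod_mul_distrib]

lemma tens_smul (c : Fin 7 → ℂ) (A : Fin 7 → Matrix (Fin 2) (Fin 2) ℂ) :
    tens (fun k => c k • A k) = (∏ k, c k) • tens A := by
  ext x y
  simp [tens, Finset.prod_mul_distrib]

lemma tens_one : tens (fun _ => 1) = 1 := by
  ext x y
  simp only [tens, Matrix.of_apply, Matrix.one_apply]
  rw [Finset.prod_ite_zero]
  simp [funext_iff]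

lemma tens_transpose (A : Fin 7 → Matrix (Fin 2) (Fin 2) ℂ) :
    (tens A)ᵀ = tens (fun k => (A k)ᵀ) := by
  ext x y
  simp [tens]

lemma tens_conjTranspose (A : Fin 7 → Matrix (Fin 2) (Fin 2) ℂ) :
    (tens A)ᴴ = tens (fun k => (A k)ᴴ) := by
  ext x y
  simp [tens, Matrix.conjTranspose_apply]

lemma pauli_zero : pauli 0 = 1 := by
  ext i j; fin_cases i <;> fin_cases j <;> simp [pauli]

lemma pauli_herm (a : Fin 4) : (pauli a)ᴴ = pauli a := by
  ext i j
  fin_cases a <;> fin_cases i <;> fin_cases j <;> simp [pauli, Matrix.conjTranspose_apply]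

lemma pauli_sq (a : Fin 4) : pauli a * pauli a = 1 := by
  ext i j
  fin_cases a <;> fin_cases i <;> fin_cases j <;> simp [pauli, Matrix.mul_apply, Fin.sum_univ_two]

lemma pauli_flip (a : Fin 4) :
    pauli 2 * (pauli a)ᵀ * pauli 2 = (if a = 0 then (1 : ℂ) else -1) • pauli a := by
  ext i j
  simp only [Matrix.mul_apply, Matrix.smul_apply, Matrix.transpose_apply, Fin.sum_univ_two]
  fin_cases a <;> fin_cases i <;> fin_cases j <;> simp [pauli]

lemma pauli_twirl (a : Fin 4) :
    ∑ b, pauli b * pauli a * pauli b = (if a = 0 then (4 : ℂ) else 0) • pauli a := by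
  ext i j
  fin_cases a <;> fin_cases i <;> fin_cases j <;>
    simp [pauli, Fin.sum_univ_four] <;> norm_num

lemma pauli_mul (a b : Fin 4) : ∃ (c : Fin 4) (z : ℂ), pauli a * pauli b = z • pauli c ∧
    (c = 0 ↔ a = b) := by
  have I : ∀ A B : Matrix (Fin 2) (Fin 2) ℂ, A = B ↔
      (A 0 0 = B 0 0 ∧ A 0 1 = B 0 1 ∧ A 1 0 = B 1 0 ∧ A 1 1 = B 1 1) := by
    intro A B
    constructor
    · rintro rfl; simp
    · rintro ⟨h1, h2, h3, h4⟩
      ext i j; fin_cases i <;> fin_cases j <;> assumption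
  refine ⟨![![0,1,2,3],![1,0,3,2],![2,3,0,1],![3,2,1,0]] a b,
    ![![1,1,1,1],![1,1,Complex.I,-Complex.I],![1,-Complex.I,1,Complex.I],
      ![1,Complex.I,-Complex.I,1]] a b, ?_, ?_⟩
  · rw [I]
    fin_cases a <;> fin_cases b <;> simp [pauli, Matrix.mul_apply, Fin.sum_univ_two]
  · revert a b; decide

lemma pauli_complete (i j i' j' : Fin 2) :
    ∑ a, pauli a i j * pauli a i' j' = if i = j' ∧ j = i' then 2 else 0 := by
  fin_cases i <;> fin_cases j <;> fin_cases i' <;> fin_cases j' <;>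
    simp [pauli, Fin.sum_univ_four] <;> norm_num

local notation "E" => pauliString 7

lemma E_herm (s : Fin 7 → Fin 4) : (E s)ᴴ = E s := by
  simp [pauliString_eq, tens_conjTranspose, pauli_herm]

lemma E_sq (s : Fin 7 → Fin 4) : E s * E s = 1 := by
  simp [pauliString_eq, tens_mul, pauli_sq, tens_one]

lemma E_zero : E 0 = 1 := by
  simp [pauliString_eq, pauli_zero, tens_one]

lemma E_complete (M : M7) : (128 : ℂ) • M = ∑ u, (E u * M).trace • E u := by
  ext x y
  have key : ∀ a b : Fin 7 → Fin 2, ∑ u, E u a b * E u x y =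
      if a = y ∧ b = x then 128 else 0 := by
    intro a b
    simp only [pauliString_eq, tens, Matrix.of_apply, ← Finset.prod_mul_distrib]
    have := (Finset.prod_univ_sum (fun _ : Fin 7 => (Finset.univ : Finset (Fin 4)))
      (fun k c => pauli c (a k) (b k) * pauli c (x k) (y k)))
    rw [Fintype.piFinset_univ] at this
    rw [← this]
    simp only [pauli_complete]
    rw [Finset.prod_ite_zero]
    simp only [Finset.mem_univ, forall_true_left, forall_and, funext_iff]
    norm_num
  simp only [Matrix.sum_apply, Matrix.smul_apply, Matrix.trace, Matrix.diag_apply,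
    Matrix.mul_apply, smul_eq_mul, Finset.sum_mul]
  rw [Finset.sum_comm]
  have : ∀ a, ∑ u, ∑ b, E u a b * M b a * E u x y = ∑ b, M b a * ∑ u, E u a b * E u x y := by
    intro a
    rw [Finset.sum_comm]
    refine Finset.sum_congr rfl fun b _ => ?_
    rw [Finset.mul_sum]
    exact Finset.sum_congr rfl fun u _ => by ring
  simp only [this, key, ite_and]
  simp [mul_comm]

/-- Pauli labels supported on `K`. -/
def lab (K : Finset (Fin 7)) : Finset (Fin 7 → Fin 4) :=
  Fintype.piFinset (fun k => if k ∈ K then Finset.univ else {0})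

lemma mem_lab {K : Finset (Fin 7)} {s : Fin 7 → Fin 4} : s ∈ lab K ↔ ∀ k, k ∉ K → s k = 0 := by
  simp only [lab, Fintype.mem_piFinset]
  refine forall_congr' fun k => ?_
  by_cases h : k ∈ K <;> simp [h]

lemma wt_lab {K : Finset (Fin 7)} {s : Fin 7 → Fin 4} (h : s ∈ lab K) : wt s ≤ K.card := by
  refine Finset.card_le_card fun k hk => ?_
  simp only [Finset.mem_filter] at hk
  by_contra hK
  exact hk.2 (mem_lab.1 h k hK)

lemma wt_pos {s : Fin 7 → Fin 4} (h : s ≠ 0) : 1 ≤ wt s := by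
  obtain ⟨k, hk⟩ := Function.ne_iff.1 h
  exact Finset.card_pos.2 ⟨k, by simpa using hk⟩

lemma E_mul {K : Finset (Fin 7)} {s t : Fin 7 → Fin 4} (hs : s ∈ lab K) (ht : t ∈ lab K)
    (hne : s ≠ t) : ∃ r ∈ lab K, ∃ z : ℂ, r ≠ 0 ∧ E s * E t = z • E r := by
  choose c z h1 h2 using pauli_mul
  refine ⟨fun k => c (s k) (t k), ?_, ∏ k, z (s k) (t k), ?_, ?_⟩
  · rw [mem_lab] at *
    intro k hk
    rw [h2, hs k hk, ht k hk]
  · obtain ⟨k, hk⟩ := Function.ne_iff.1 hne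
    intro h
    exact hk ((h2 _ _).1 (congrFun h k))
  · simp only [pauliString_eq, tens_mul, h1, tens_smul]

/-- The twirl over `K`. -/
noncomputable def Q (K : Finset (Fin 7)) (M : M7) : M7 := ∑ s ∈ lab K, E s * M * E s

lemma Q_E (K : Finset (Fin 7)) (u : Fin 7 → Fin 4) :
    Q K (E u) = (if ∀ k ∈ K, u k = 0 then (4 : ℂ) ^ K.card else 0) • E u := by
  have h1 : Q K (E u) = tens (fun k => (if k ∈ K then (if u k = 0 then (4 : ℂ) else 0) else 1) •
      pauli (u k)) := by
    ext x y
    simp only [Q, pauliString_eq, tens_mul, Matrix.sum_apply, lab]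
    simp only [tens, Matrix.of_apply]
    rw [← Finset.prod_univ_sum (fun k => if k ∈ K then Finset.univ else {0})
      (fun k a => (pauli a * pauli (u k) * pauli a) (x k) (y k))]
    refine Finset.prod_congr rfl fun k _ => ?_
    by_cases h : k ∈ K
    · simp only [h, if_true]
      rw [← pauli_twirl, Matrix.sum_apply]
    · simp [h, pauli_zero]
  rw [h1, tens_smul, ← pauliString_eq]
  congr 1
  rw [Finset.prod_ite, Finset.prod_const_one, mul_one]
  rw [Finset.prod_ite_zero]
  simp

lemma Q_sum {ι : Type*} (K : Finset (Fin 7)) (S : Finset ι) (c : ι → ℂ) (f : ι → M7) :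
    Q K (∑ i ∈ S, c i • f i) = ∑ i ∈ S, c i • Q K (f i) := by
  simp only [Q, Finset.smul_sum, Finset.mul_sum, Finset.sum_mul]
  rw [Finset.sum_comm]
  simp

lemma Q_smul (K : Finset (Fin 7)) (c : ℂ) (M : M7) : Q K (c • M) = c • Q K M := by
  simp [Q, Finset.smul_sum]

/-- Spin flip. -/
noncomputable def flip7 (M : M7) : M7 := E (fun _ => 2) * Mᵀ * E (fun _ => 2)

lemma flip7_mul (A B : M7) : flip7 (A * B) = flip7 B * flip7 A := by
  simp only [flip7, Matrix.transpose_mul]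
  have := E_sq (fun _ => 2)
  calc _ = E (fun _ => 2) * (Bᵀ * 1 * Aᵀ) * E (fun _ => 2) := by simp
    _ = _ := by rw [← this]; simp only [Matrix.mul_assoc]

lemma flip7_sum {ι : Type*} (S : Finset ι) (c : ι → ℂ) (f : ι → M7) :
    flip7 (∑ i ∈ S, c i • f i) = ∑ i ∈ S, c i • flip7 (f i) := by
  simp [flip7, Matrix.transpose_sum, Finset.mul_sum, Finset.sum_mul]

lemma flip7_smul (c : ℂ) (M : M7) : flip7 (c • M) = c • flip7 M := by
  simp [flip7]

lemma flip7_E (u : Fin 7 → Fin 4) : flip7 (E u) = ((-1 : ℂ) ^ wt u) • E u := by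
  simp only [flip7, pauliString_eq, tens_transpose, tens_mul, pauli_flip, tens_smul]
  congr 1
  rw [Finset.prod_ite]
  simp [wt]

lemma Q_P {P : M7} (hP : ∀ M : M7, P * M * P = (M * P).trace • P) (h1 : P.trace = 1)
    (hc : ∀ s : Fin 7 → Fin 4, 1 ≤ wt s → wt s ≤ 3 → (E s * P).trace = 0) {K : Finset (Fin 7)} (hK : K.card ≤ 3) : Q K P * P = P := by
  rw [Q, Finset.sum_mul, Finset.sum_eq_single 0]
  · have := hP 1
    simp only [mul_one, one_mul, h1, one_smul] at this
    simp [E_zero, this]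
  · intro s hs h0
    rw [Matrix.mul_assoc, Matrix.mul_assoc, ← Matrix.mul_assoc P, hP,
      hc s (wt_pos h0) ((wt_lab hs).trans hK)]
    simp
  · intro h
    exact (h (mem_lab.2 (by simp))).elim

lemma Q_idem {P : M7} (hP : ∀ M : M7, P * M * P = (M * P).trace • P) (h1 : P.trace = 1)
    (hc : ∀ s : Fin 7 → Fin 4, 1 ≤ wt s → wt s ≤ 3 → (E s * P).trace = 0) {K : Finset (Fin 7)} (hK : K.card ≤ 3) : Q K P * Q K P = Q K P := by
  have hPP := hP 1
  simp only [mul_one, one_mul, h1, one_smul] at hPP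
  rw [Q, Finset.sum_mul]
  refine Finset.sum_congr rfl fun s hs => ?_
  rw [Finset.mul_sum, Finset.sum_eq_single s]
  · calc _ = E s * (P * (E s * E s) * P) * E s := by simp only [Matrix.mul_assoc]
      _ = _ := by rw [E_sq, mul_one, hPP]
  · intro t ht hne
    obtain ⟨r, hr, z, hr0, hz⟩ := E_mul hs ht hne.symm
    calc _ = E s * (P * (E s * E t) * P) * E t := by simp only [Matrix.mul_assoc]
      _ = 0 := by
        rw [hP, hz, Matrix.smul_mul, Matrix.trace_smul,
          hc r (wt_pos hr0) ((wt_lab hr).trans hK)]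
        simp
  · intro h; exact (h hs).elim

set_option maxRecDepth 100000 in
lemma comb (b : Fin 7 → Bool) (h : 4 ≤ (Finset.univ.filter fun k => b k = true).card) :
    2 * ((if ∀ k ∈ ({0,1} : Finset (Fin 7)), b k = false then (16 : ℤ) else 0) *
      (-1) ^ (Finset.univ.filter fun k => b k = true).card) =
    (∑ j ∈ ({2,3,4,5,6} : Finset (Fin 7)),
      (if ∀ k ∈ ({0,1,j} : Finset (Fin 7)), b k = false then (64 : ℤ) else 0)) -
    2 * (if ∀ k ∈ ({0,1} : Finset (Fin 7)), b k = false then (16 : ℤ) else 0) := by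
  revert b; decide

lemma comb2 (u : Fin 7 → Fin 4) (h : 4 ≤ wt u) :
    2 * ((if ∀ k ∈ ({0,1} : Finset (Fin 7)), u k = 0 then (16 : ℂ) else 0) * (-1) ^ wt u) =
    (∑ j ∈ ({2,3,4,5,6} : Finset (Fin 7)),
      (if ∀ k ∈ ({0,1,j} : Finset (Fin 7)), u k = 0 then (64 : ℂ) else 0)) -
    2 * (if ∀ k ∈ ({0,1} : Finset (Fin 7)), u k = 0 then (16 : ℂ) else 0) := by
  have := comb (fun k => decide (u k ≠ 0)) (by simpa [wt] using h)
  simp only [decide_eq_true_eq, decide_eq_false_iff_not, not_not] at this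
  exact_mod_cast this

lemma flip_formula {P : M7} (h1 : P.trace = 1)
    (hc : ∀ s : Fin 7 → Fin 4, 1 ≤ wt s → wt s ≤ 3 → (E s * P).trace = 0) : (2 : ℂ) • flip7 (Q {0,1} P) =
    ∑ j ∈ ({2,3,4,5,6} : Finset (Fin 7)), Q {0,1,j} P - (2 : ℂ) • 1 - (2 : ℂ) • Q {0,1} P := by
  have h128 : (128 : ℂ) ≠ 0 := by norm_num
  have hQ : ∀ K, (128 : ℂ) • Q K P = ∑ u, (E u * P).trace • Q K (E u) := by
    intro K; rw [← Q_smul, E_complete, Q_sum]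
  have hF : (128 : ℂ) • flip7 (Q {0,1} P) = ∑ u, (E u * P).trace • flip7 (Q {0,1} (E u)) := by
    rw [← flip7_smul, hQ, flip7_sum]
  have hone : (1 : M7) = ∑ u : Fin 7 → Fin 4, (if u = 0 then (1 : ℂ) else 0) • E u := by
    simp [E_zero]
  have hs : ∀ A B : M7, (128 : ℂ) • A = (128 : ℂ) • B → A = B := by
    intro A B h
    exact smul_right_injective _ h128 h
  apply hs
  rw [smul_comm, hF, smul_sub, smul_sub, smul_comm (128 : ℂ) (2 : ℂ) (Q _ _), hQ,
    Finset.smul_sum (r := (128 : ℂ)) (s := {2,3,4,5,6}),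
    Finset.sum_congr rfl (fun j _ => hQ {0,1,j}), Finset.sum_comm, hone]
  simp only [Finset.smul_sum, ← Finset.sum_sub_distrib]
  refine Finset.sum_congr rfl fun u _ => ?_
  simp only [Q_E, flip7_smul, flip7_E, smul_smul, ← Finset.sum_smul, ← sub_smul]
  congr 1
  have c2 : ({0,1} : Finset (Fin 7)).card = 2 := by decide
  have c3 : ∀ j ∈ ({2,3,4,5,6} : Finset (Fin 7)), ({0,1,j} : Finset (Fin 7)).card = 3 := by decide
  rw [c2, Finset.sum_congr rfl (g := fun j => (E u * P).trace *
    (if ∀ k ∈ ({0,1,j} : Finset (Fin 7)), u k = 0 then (64 : ℂ) else 0))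
    (fun j hj => by rw [c3 j hj]; norm_num), ← Finset.mul_sum]
  by_cases hu : u = 0
  · subst hu
    simp [E_zero, h1, wt]
    norm_num
  · by_cases hw : wt u ≤ 3
    · rw [hc u (wt_pos hu) hw]
      simp [hu]
    · have := comb2 u (by omega)
      rw [if_neg hu, show (4 : ℂ) ^ 2 = 16 by norm_num]
      linear_combination (E u * P).trace * this

lemma no_ame {P : M7} (hP : ∀ M : M7, P * M * P = (M * P).trace • P) (h1 : P.trace = 1)
    (hc : ∀ s : Fin 7 → Fin 4, 1 ≤ wt s → wt s ≤ 3 → (E s * P).trace = 0) : False := by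
  have hf := flip_formula h1 hc
  have hN : flip7 (Q {0,1} P) * flip7 (Q {0,1} P) = flip7 (Q {0,1} P) := by
    rw [← flip7_mul, Q_idem hP h1 hc (by decide)]
  generalize flip7 (Q {0,1} P) = N at hf hN
  have h3 : (2 : ℂ) • (N * P) = P := by
    rw [← Matrix.smul_mul, hf]
    simp only [Matrix.sub_mul, Finset.sum_mul, Matrix.smul_mul, one_mul]
    rw [Q_P hP h1 hc (by decide), Finset.sum_congr rfl
      (g := fun _ => P) (fun j hj => Q_P hP h1 hc (by revert j; decide))]
    simp only [Finset.sum_const]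
    have : ({2,3,4,5,6} : Finset (Fin 7)).card = 5 := by decide
    rw [this]
    module
  have h4 : N * P = 0 := by
    have : (2 : ℂ) • (N * (N * P)) = N * P := by
      rw [← Matrix.mul_smul, h3]
    rw [← Matrix.mul_assoc, hN, h3] at this
    have e : P = (2 : ℂ) • P - P := by module
    rw [← this]
    rw [← this] at h3
    rw [e, h3, sub_self]
  rw [h4, smul_zero] at h3
  rw [← h3] at h1
  simp at h1

lemma spec {σ : M7} (h : σ.PosSemidef) (h1 : σ.trace = 1) :
    ∃ (U : M7) (l : (Fin 7 → Fin 2) → ℝ), Uᴴ * U = 1 ∧ (∀ i, 0 ≤ l i) ∧ ∑ i, l i = 1 ∧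
      σ = U * diagonal (fun i => (l i : ℂ)) * Uᴴ ∧ (σ * σ).trace = ((∑ i, l i ^ 2 : ℝ) : ℂ) := by
  have hs := h.1.spectral_theorem
  have hU : (h.1.eigenvectorUnitary : M7)ᴴ * (h.1.eigenvectorUnitary : M7) = 1 :=
    Unitary.coe_star_mul_self h.1.eigenvectorUnitary
  rw [Unitary.conjStarAlgAut_apply] at hs
  generalize (h.1.eigenvectorUnitary : M7) = U at hs hU
  have hs' : σ = U * diagonal (fun i => (h.1.eigenvalues i : ℂ)) * Uᴴ := hs
  refine ⟨U, h.1.eigenvalues, hU, fun i => h.eigenvalues_nonneg i, ?_, hs', ?_⟩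
  · have := h.1.trace_eq_sum_eigenvalues
    rw [h1] at this
    have h5 := congrArg Complex.re this
    simpa using h5.symm
  · generalize h.1.eigenvalues = l at hs'
    rw [hs']
    calc _ = (U * (diagonal (fun i => (l i : ℂ)) * (Uᴴ * U) *
          diagonal (fun i => (l i : ℂ))) * Uᴴ).trace := by simp only [Matrix.mul_assoc]
      _ = _ := by
        rw [hU, mul_one, Matrix.trace_mul_comm, ← Matrix.mul_assoc, hU, one_mul,
          diagonal_mul_diagonal, trace_diagonal]
        push_cast
        exact Finset.sum_congr rfl fun i _ => by ring

lemma purity_le {σ : M7} (h : σ.PosSemidef) (h1 : σ.trace = 1) : (σ * σ).trace.re ≤ 1 := by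
  obtain ⟨U, l, hU, h0, hl, hs, ht⟩ := spec h h1
  rw [ht, Complex.ofReal_re, ← hl]
  refine Finset.sum_le_sum fun i _ => ?_
  have : l i ≤ 1 := hl ▸ Finset.single_le_sum (fun j _ => h0 j) (Finset.mem_univ i)
  nlinarith [h0 i]

lemma pure_of_purity {σ : M7} (h : σ.PosSemidef) (h1 : σ.trace = 1) (h2 : (σ * σ).trace.re = 1)
    (M : M7) : σ * M * σ = (M * σ).trace • σ := by
  obtain ⟨U, l, hU, h0, hl, hs, ht⟩ := spec h h1
  rw [ht, Complex.ofReal_re] at h2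
  have hle : ∀ i, l i ≤ 1 := fun i =>
    hl ▸ Finset.single_le_sum (fun j _ => h0 j) (Finset.mem_univ i)
  have hz : ∑ i, (l i - l i ^ 2) = 0 := by rw [Finset.sum_sub_distrib, hl, h2, sub_self]
  rw [Finset.sum_eq_zero_iff_of_nonneg (fun i _ => by nlinarith [h0 i, hle i])] at hz
  obtain ⟨i, -, hi⟩ : ∃ i ∈ Finset.univ, l i ≠ 0 := by
    by_contra! hc
    rw [Finset.sum_eq_zero hc] at hl
    exact zero_ne_one hl
  have hi1 : l i = 1 := by
    have h3 := hz i (Finset.mem_univ i)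
    have : l i * (1 - l i) = 0 := by linarith
    rcases mul_eq_zero.1 this with h | h
    · exact (hi h).elim
    · linarith
  have hj : ∀ j, j ≠ i → l j = 0 := by
    intro j hj
    have := Finset.add_le_sum (s := Finset.univ) (f := l) (fun k _ => h0 k)
      (Finset.mem_univ i) (Finset.mem_univ j) hj.symm
    linarith [h0 j]
  have hd : diagonal (fun i => (l i : ℂ)) = Matrix.single i i (1 : ℂ) := by
    ext a b
    by_cases hab : a = b
    · subst hab
      by_cases ha : a = i
      · subst ha; simp [hi1]
      · simp [hj a ha, Matrix.single, Ne.symm ha]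
    · rw [diagonal_apply_ne _ hab, Matrix.single_apply, if_neg]
      rintro ⟨rfl, rfl⟩; exact hab rfl
  rw [hd] at hs
  have key : ∀ X : M7, Matrix.single i i (1 : ℂ) * X * Matrix.single i i (1 : ℂ) =
      X i i • Matrix.single i i (1 : ℂ) := by
    intro X
    rw [Matrix.single_mul_mul_single]
    simp
  have ht : (M * σ).trace = (Uᴴ * M * U) i i := by
    rw [hs, ← Matrix.mul_assoc, Matrix.trace_mul_comm, ← Matrix.mul_assoc, ← Matrix.mul_assoc,
      Matrix.trace_mul_single]
    simp
  rw [ht, hs]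
  calc _ = U * (Matrix.single i i (1 : ℂ) * (Uᴴ * M * U) * Matrix.single i i (1 : ℂ)) * Uᴴ := by
        simp only [Matrix.mul_assoc]
    _ = _ := by rw [key, Matrix.mul_smul, Matrix.smul_mul]

lemma sub_purity {σ τ : M7} (hs : σ.PosSemidef) (ht : τ.PosSemidef) :
    0 ≤ ((σ - τ) * (σ - τ)).trace.re ∧ (((σ - τ) * (σ - τ)).trace.re = 0 → σ = τ) ∧
    ((σ - τ) * (σ - τ)).trace.re = (σ * σ).trace.re + (τ * τ).trace.re - 2 * (σ * τ).trace.re := by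
  have hh : (σ - τ)ᴴ = σ - τ := (hs.1.sub ht.1)
  have hps : 0 ≤ ((σ - τ) * (σ - τ)).trace := by
    have := (Matrix.posSemidef_conjTranspose_mul_self (σ - τ)).trace_nonneg
    rwa [hh] at this
  refine ⟨(Complex.le_def.1 hps).1, fun h0 => ?_, ?_⟩
  · have : ((σ - τ)ᴴ * (σ - τ)).trace = 0 := by
      rw [hh]
      exact Complex.ext h0 (Complex.le_def.1 hps).2.symm
    exact sub_eq_zero.1 (Matrix.trace_conjTranspose_mul_self_eq_zero_iff.1 this)
  · simp only [Matrix.sub_mul, Matrix.mul_sub, Matrix.trace_sub, Complex.sub_re]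
    rw [Matrix.trace_mul_comm τ σ]
    ring

lemma swap_trace (A B : M7) : (swapN 7 * (A ⊗ₖ B)).trace = (A * B).trace := by
  simp only [Matrix.trace, Matrix.diag_apply, Matrix.mul_apply, swapN, Matrix.of_apply,
    Matrix.kroneckerMap_apply, Fintype.sum_prod_type, ite_and]
  simp [Finset.sum_ite_eq]
  rw [Finset.sum_comm]

/-- Corollary: any state with the `Φ_E8` correlations (unit trace, unit swap
expectation, and Pauli correlations `w(wt s)`) is not separable. -/
theorem stmt13 (ρ : Matrix ((Fin 7 → Fin 2) × (Fin 7 → Fin 2))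
      ((Fin 7 → Fin 2) × (Fin 7 → Fin 2)) ℂ)
    (hpsd : ρ.PosSemidef) (htr : ρ.trace = 1)
    (hswap : (swapN 7 * ρ).trace = 1)
    (hcorr : ∀ s : Fin 7 → Fin 4,
      ((pauliString 7 s ⊗ₖ (pauliString 7 s)ᴴ) * ρ).trace = ((wFn (wt s) : ℝ) : ℂ)) :
    ¬ ∃ (m : ℕ) (p : Fin m → ℝ)
        (σ τ : Fin m → Matrix (Fin 7 → Fin 2) (Fin 7 → Fin 2) ℂ),
      (∀ i, 0 ≤ p i) ∧
      (∀ i, (σ i).PosSemidef ∧ (σ i).trace = 1) ∧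
      (∀ i, (τ i).PosSemidef ∧ (τ i).trace = 1) ∧
      ρ = ∑ i, (p i : ℂ) • (σ i ⊗ₖ τ i) := by
  rintro ⟨m, p, σ, τ, hp, hσ, hτ, rfl⟩
  have hsum : ∑ i, p i = 1 := by
    simp only [Matrix.trace_sum, Matrix.trace_smul, Matrix.trace_kronecker, (hσ _).2, (hτ _).2,
      smul_eq_mul, mul_one] at htr
    exact_mod_cast htr
  have hsw : ∑ i, p i * (σ i * τ i).trace.re = 1 := by
    simp only [Finset.mul_sum, Matrix.mul_smul, Matrix.trace_sum, Matrix.trace_smul, swap_trace,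
      smul_eq_mul] at hswap
    have := congrArg Complex.re hswap
    simpa using this
  have hbd : ∀ i, (σ i * τ i).trace.re ≤ 1 := by
    intro i
    obtain ⟨h1, -, h3⟩ := sub_purity (hσ i).1 (hτ i).1
    linarith [purity_le (hσ i).1 (hσ i).2, purity_le (hτ i).1 (hτ i).2]
  have hz : ∑ i, p i * (1 - (σ i * τ i).trace.re) = 0 := by
    simp only [mul_sub, mul_one, Finset.sum_sub_distrib, hsum, hsw, sub_self]
  rw [Finset.sum_eq_zero_iff_of_nonneg
    (fun i _ => mul_nonneg (hp i) (sub_nonneg.2 (hbd i)))] at hz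
  have hpure : ∀ i, p i ≠ 0 → σ i = τ i ∧ (σ i * σ i).trace.re = 1 := by
    intro i hi
    have h4 := (mul_eq_zero.1 (hz i (Finset.mem_univ i))).resolve_left hi
    obtain ⟨h1, h2, h3⟩ := sub_purity (hσ i).1 (hτ i).1
    have h5 := purity_le (hσ i).1 (hσ i).2
    have h6 := purity_le (hτ i).1 (hτ i).2
    exact ⟨h2 (by linarith), by linarith⟩
  obtain ⟨i, -, hi⟩ : ∃ i ∈ Finset.univ, p i ≠ 0 := by
    by_contra! hc
    rw [Finset.sum_eq_zero hc] at hsum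
    exact zero_ne_one hsum
  refine no_ame (pure_of_purity (hσ i).1 (hσ i).2 (hpure i hi).2) (hσ i).2 ?_
  intro s hs1 hs3
  have hw : wFn (wt s) = 0 := by
    interval_cases wt s <;> simp [wFn]
  have hreal : ∀ j, (((E s) * σ j).trace).im = 0 := by
    intro j
    apply Complex.conj_eq_iff_im.1
    have := Matrix.trace_conjTranspose ((E s) * σ j)
    rw [Matrix.conjTranspose_mul, E_herm, (hσ j).1.1, Matrix.trace_mul_comm] at this
    exact this.symm
  have hc := hcorr s
  simp only [hw, Finset.mul_sum, Matrix.mul_smul, Matrix.trace_sum, Matrix.trace_smul,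
    ← Matrix.mul_kronecker_mul, Matrix.trace_kronecker, E_herm, smul_eq_mul] at hc
  have hc2 : ∑ j, p j * ((E s * σ j).trace.re) ^ 2 = 0 := by
    have hre := congrArg Complex.re hc
    rw [Complex.re_sum] at hre
    simp only [Complex.ofReal_zero, Complex.zero_re] at hre
    rw [← hre]
    refine Finset.sum_congr rfl fun j _ => ?_
    by_cases hj : p j = 0
    · simp [hj]
    · rw [← (hpure j hj).1]
      simp [Complex.mul_re, hreal j]
      left; ring
  rw [Finset.sum_eq_zero_iff_of_nonneg (fun j _ => mul_nonneg (hp j) (sq_nonneg _))] at hc2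
  have h7 := (mul_eq_zero.1 (hc2 i (Finset.mem_univ i))).resolve_left hi
  exact Complex.ext (pow_eq_zero_iff (two_ne_zero)|>.1 h7) (hreal i)
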